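/- Fix a polynomial initial value problem over variables S = {x_1,…,x_n}, a partition G of S, and a real number ε ≥ 0. Then there exists a unique coarsest ε-FDE partition of S refining G; that is, there exists an ε-FDE partition H refining G such that every ε-FDE partition of S refining G refines H. -/

import Mathlib

open MvPolynomial

noncomputable section

/-- The sum of the absolute values of the coefficients of a multivariate polynomial
(in normal form, where each monomial appears at most once). -/
def coeffAbsSum {σ : Type*} (p : MvPolynomial σ ℝ) : ℝ :=
  ∑ α ∈ p.support, |coeff α p|

/-- The representative variable of the block of `i` in the partition `s`. -/
def ptrep {n : ℕ} (s : Setoid (Fin n)) (i : Fin n) : Fin n :=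
  (Quotient.mk s i).out

/-- `s` refines `t` : every block of `s` is contained in some block of `t`. -/
def Refines {n : ℕ} (s t : Setoid (Fin n)) : Prop :=
  ∀ i j : Fin n, s.r i j → t.r i j

/-- A polynomial over the variables `S`, viewed as a polynomial over `S ∪ {s}`, where the
fresh variable `s` is encoded as `none`. -/
def liftP {n : ℕ} (p : MvPolynomial (Fin n) ℝ) : MvPolynomial (Option (Fin n)) ℝ :=
  rename some p

/-- The substitution `x_i ↦ s (x_i + x_j)`, `x_j ↦ (1 - s) (x_i + x_j)`, with the fresh
variable `s` encoded as `none`. -/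
def fdeSubst {n : ℕ} (i j : Fin n) : Option (Fin n) → MvPolynomial (Option (Fin n)) ℝ :=
  fun v =>
    if v = some i then X none * (X (some i) + X (some j))
    else if v = some j then (1 - X none) * (X (some i) + X (some j))
    else X v

open Classical in
/-- The polynomial `p^{H_k}_{i,j} = Σ_{x_l ∈ H_k} q_l − Σ_{x_l ∈ H_k} q_l[x_i ↦ s(x_i+x_j),
x_j ↦ (1−s)(x_i+x_j)]` over the variables `S ∪ {s}`, where `H_k` is the block of `k` in the
partition `s`. -/
def blockDiff {n : ℕ} (q : Fin n → MvPolynomial (Fin n) ℝ) (s : Setoid (Fin n))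
    (k i j : Fin n) : MvPolynomial (Option (Fin n)) ℝ :=
  (∑ l ∈ Finset.univ.filter fun l => s.r l k, liftP (q l)) -
    ∑ l ∈ Finset.univ.filter fun l => s.r l k, aeval (fdeSubst i j) (liftP (q l))

open Classical in
/-- `Σ_{k=1}^m` (sum of the absolute values of the coefficients of `p^{H_k}_{i,j}` in normal
form), the sum ranging over all blocks of the partition `s` (every block is represented
exactly once, by its representative). -/
def fdeSum {n : ℕ} (q : Fin n → MvPolynomial (Fin n) ℝ) (s : Setoid (Fin n))
    (i j : Fin n) : ℝ :=
  ∑ k ∈ Finset.univ.filter fun k => ptrep s k = k, coeffAbsSum (blockDiff q s k i j)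

/-- `x_i ∼^F_{H,ε} x_j`. -/
def simF {n : ℕ} (q : Fin n → MvPolynomial (Fin n) ℝ) (s : Setoid (Fin n)) (ε : ℝ)
    (i j : Fin n) : Prop :=
  fdeSum q s i j ≤ ε

/-- `s` is an `ε`-FDE partition : `s = S / (∼^{F*}_{s,ε} ∩ ∼_s)`, where `∼^{F*}_{s,ε}` is the
(equivalence) closure of `∼^F_{s,ε}` and `∼_s` is the equivalence relation induced by `s`. -/
def IsEpsFDE {n : ℕ} (q : Fin n → MvPolynomial (Fin n) ℝ) (s : Setoid (Fin n)) (ε : ℝ) : Prop :=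
  ∀ i j : Fin n, s.r i j ↔ (Relation.EqvGen (simF q s ε) i j ∧ s.r i j)

lemma coeffAbsSum_eq_sum_of_support_subset {σ : Type*} (p : MvPolynomial σ ℝ)
    {A : Finset (σ →₀ ℕ)} (h : p.support ⊆ A) : coeffAbsSum p = ∑ α ∈ A, |coeff α p| :=
  Finset.sum_subset h fun α _ hα => by simp [notMem_support_iff.mp hα]

lemma coeffAbsSum_zero {σ : Type*} : coeffAbsSum (0 : MvPolynomial σ ℝ) = 0 := by
  simp [coeffAbsSum]

lemma coeffAbsSum_add_le {σ : Type*} (p r : MvPolynomial σ ℝ) :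
    coeffAbsSum (p + r) ≤ coeffAbsSum p + coeffAbsSum r := by
  classical
  rw [coeffAbsSum_eq_sum_of_support_subset (p + r) support_add,
    coeffAbsSum_eq_sum_of_support_subset p Finset.subset_union_left,
    coeffAbsSum_eq_sum_of_support_subset r Finset.subset_union_right,
    ← Finset.sum_add_distrib]
  exact Finset.sum_le_sum fun α _ => by simpa using abs_add_le (coeff α p) (coeff α r)

lemma coeffAbsSum_sum_le {σ ι : Type*} (A : Finset ι) (f : ι → MvPolynomial σ ℝ) :
    coeffAbsSum (∑ a ∈ A, f a) ≤ ∑ a ∈ A, coeffAbsSum (f a) :=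
  Finset.le_sum_of_subadditive coeffAbsSum coeffAbsSum_zero.le coeffAbsSum_add_le A f

lemma ptrep_rel {n : ℕ} (s : Setoid (Fin n)) (i : Fin n) : s.r (ptrep s i) i :=
  Quotient.mk_out (s := s) i

lemma ptrep_eq_of_rel {n : ℕ} (s : Setoid (Fin n)) {i j : Fin n} (h : s.r i j) :
    ptrep s i = ptrep s j :=
  congrArg Quotient.out (Quotient.sound (s := s) h)

lemma rel_iff_ptrep_eq {n : ℕ} (s : Setoid (Fin n)) (i : Fin n) {k : Fin n}
    (hk : ptrep s k = k) : s.r i k ↔ ptrep s i = k :=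
  ⟨fun h => (ptrep_eq_of_rel s h).trans hk,
    fun h => s.iseqv.symm (h ▸ ptrep_rel s i)⟩

lemma ptrep_ptrep {n : ℕ} (s : Setoid (Fin n)) (i : Fin n) :
    ptrep s (ptrep s i) = ptrep s i :=
  ptrep_eq_of_rel s (ptrep_rel s i)

lemma Refines.ptrep_ptrep {n : ℕ} {s t : Setoid (Fin n)} (h : Refines s t) (i : Fin n) :
    ptrep t (ptrep s i) = ptrep t i :=
  ptrep_eq_of_rel t (h _ _ (ptrep_rel s i))

open Classical in
lemma blockDiff_eq_sum {n : ℕ} (q : Fin n → MvPolynomial (Fin n) ℝ) (s : Setoid (Fin n))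
    {k : Fin n} (hk : ptrep s k = k) (i j : Fin n) :
    blockDiff q s k i j = ∑ l ∈ Finset.univ.filter fun l => ptrep s l = k,
      (liftP (q l) - aeval (fdeSubst i j) (liftP (q l))) := by
  simp only [blockDiff, rel_iff_ptrep_eq s _ hk, Finset.sum_sub_distrib]

open Classical in
/-- Each block difference of a coarser partition is the sum of the block differences of the
finer blocks it contains. -/
lemma Refines.blockDiff_eq_sum {n : ℕ} (q : Fin n → MvPolynomial (Fin n) ℝ)
    {s t : Setoid (Fin n)} (h : Refines s t) {k : Fin n} (hk : ptrep t k = k) (i j : Fin n) :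
    blockDiff q t k i j = ∑ m ∈ (Finset.univ.filter fun m => ptrep s m = m).filter
      (fun m => ptrep t m = k), blockDiff q s m i j := by
  rw [_root_.blockDiff_eq_sum q t hk, ← Finset.sum_fiberwise_of_maps_to (g := ptrep s)
    (t := (Finset.univ.filter fun m => ptrep s m = m).filter fun m => ptrep t m = k)]
  · refine Finset.sum_congr rfl fun m hm => ?_
    simp only [Finset.mem_filter, Finset.mem_univ, true_and] at hm
    rw [_root_.blockDiff_eq_sum q s hm.1]
    refine Finset.sum_congr ?_ fun _ _ => rfl
    ext l
    simp only [Finset.mem_filter, Finset.mem_univ, true_and, and_iff_right_iff_imp]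
    rintro rfl
    rw [← h.ptrep_ptrep, hm.2]
  · intro l hl
    simp only [Finset.mem_filter, Finset.mem_univ, true_and] at hl ⊢
    exact ⟨_root_.ptrep_ptrep s l, (h.ptrep_ptrep l).trans hl⟩

/-- Coarsening the partition does not increase the total coefficient deviation. -/
lemma Refines.fdeSum_le {n : ℕ} (q : Fin n → MvPolynomial (Fin n) ℝ)
    {s t : Setoid (Fin n)} (h : Refines s t) (i j : Fin n) :
    fdeSum q t i j ≤ fdeSum q s i j := by
  classical
  unfold fdeSum
  rw [← Finset.sum_fiberwise_of_maps_to (s := Finset.univ.filter fun k => ptrep s k = k)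
    (g := ptrep t)
    (t := Finset.univ.filter fun k => ptrep t k = k)
    (fun m _ => by simp [_root_.ptrep_ptrep])]
  refine Finset.sum_le_sum fun k hk => ?_
  rw [h.blockDiff_eq_sum q (by simpa using hk)]
  exact coeffAbsSum_sum_le _ _

lemma isEpsFDE_iff {n : ℕ} (q : Fin n → MvPolynomial (Fin n) ℝ) (s : Setoid (Fin n)) (ε : ℝ) :
    IsEpsFDE q s ε ↔ s ≤ Relation.EqvGen.setoid (simF q s ε) :=
  ⟨fun h i j hij => ((h i j).mp hij).1, fun h _ _ => ⟨fun hij => ⟨h hij, hij⟩, And.right⟩⟩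

lemma isEpsFDE_sSup {n : ℕ} (q : Fin n → MvPolynomial (Fin n) ℝ) (ε : ℝ)
    {C : Set (Setoid (Fin n))} (hC : ∀ s ∈ C, IsEpsFDE q s ε) : IsEpsFDE q (sSup C) ε := by
  rw [isEpsFDE_iff]
  refine sSup_le fun s hs => ((isEpsFDE_iff q s ε).mp (hC s hs)).trans fun i j hij => ?_
  have hle : Refines s (sSup C) := fun _ _ hab => le_sSup hs hab
  exact Relation.EqvGen.mono (fun a b hab => (hle.fdeSum_le q a b).trans hab) _ _ hij

/-- for any PIVP (polynomials `q` with initial condition `σ0`), any partition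
`G` of the variables and any `ε ≥ 0`, there is a unique coarsest `ε`-FDE partition refining
`G`, i.e. an `ε`-FDE partition `H` refining `G` which is refined by every `ε`-FDE partition
refining `G`. -/
theorem exists_unique_coarsest_epsFDE {n : ℕ} (q : Fin n → MvPolynomial (Fin n) ℝ)
    (σ0 : Fin n → ℝ) (G : Setoid (Fin n)) (ε : ℝ) (hε : 0 ≤ ε) :
    ∃! H : Setoid (Fin n), IsEpsFDE q H ε ∧ Refines H G ∧
      ∀ H' : Setoid (Fin n), IsEpsFDE q H' ε → Refines H' G → Refines H' H := by
  refine ⟨sSup {s | IsEpsFDE q s ε ∧ Refines s G},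
    ⟨isEpsFDE_sSup q ε fun _ hs => hs.1, ?_, fun H' h₁ h₂ _ _ h => ?_⟩, ?_⟩
  · have hle : sSup {s | IsEpsFDE q s ε ∧ Refines s G} ≤ G :=
      sSup_le fun s hs _ _ h => hs.2 _ _ h
    exact fun _ _ h => hle h
  · have hle : H' ≤ sSup {s | IsEpsFDE q s ε ∧ Refines s G} := le_sSup ⟨h₁, h₂⟩
    exact hle h
  · rintro K ⟨hK, hKG, hmax⟩
    refine le_antisymm (le_sSup ⟨hK, hKG⟩) (sSup_le fun s hs _ _ h => hmax s hs.1 hs.2 _ _ h)
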